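/- Let A be a symmetric n×n matrix with entries in {0,1} and let m be the total number of nonzero entries of A. Suppose the index set {1,…,n} is partitioned into k pairwise disjoint groups. For each group, let u_i denote the number of distinct values occurring among the positive row sums (degrees) of the rows belonging to that group. Then u_1 + u_2 + … + u_k ≤ √(2·k·m). -/

import Mathlib

theorem card_sq_le_two_sum (S : Finset ℕ) : (∀ x ∈ S, 0 < x) → S.card ^ 2 ≤ 2 * ∑ x ∈ S, x := by
  induction S using Finset.induction_on_max with
  | empty => simp
  | insert a s hlt ih =>
    intro h
    have ha : a ∉ s := fun h => lt_irrefl _ (hlt a h)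
    have h1 := ih (fun x hx => h x (Finset.mem_insert_of_mem hx))
    have h2 : s ⊆ Finset.Ico 1 a := by
      intro x hx
      exact Finset.mem_Ico.2 ⟨h x (Finset.mem_insert_of_mem hx), hlt x hx⟩
    have h3 := Finset.card_le_card h2
    have h4 := h a (Finset.mem_insert_self _ _)
    rw [Nat.card_Ico] at h3
    rw [Finset.card_insert_of_notMem ha, Finset.sum_insert ha]
    have h5 : s.card + 1 ≤ a := by omega
    nlinarith

theorem sum_image_id_le {ι : Type*} [DecidableEq ι] (S : Finset ι) (d : ι → ℕ) :
    ∑ x ∈ S.image d, x ≤ ∑ i ∈ S, d i := by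
  induction S using Finset.induction_on with
  | empty => simp
  | insert a s ha ih =>
    rw [Finset.image_insert, Finset.sum_insert ha]
    by_cases h : d a ∈ s.image d
    · rw [Finset.insert_eq_of_mem h]; omega
    · rw [Finset.sum_insert h]; omega

/-- Let `A` be a symmetric `n × n` matrix with entries in `{0,1}` and let
`m` be the total number of nonzero entries of `A`. If the index set is partitioned into
`k` pairwise disjoint groups (given by a block assignment `β : Fin n → Fin k`), and `u g`
denotes the number of distinct values occurring among the positive row sums (degrees) of
the rows belonging to group `g`, then `u 1 + ⋯ + u k ≤ √(2 k m)`. -/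
theorem stmt_0 {n k : ℕ} (A : Matrix (Fin n) (Fin n) ℝ)
    (hsym : ∀ i j, A i j = A j i)
    (h01 : ∀ i j, A i j = 0 ∨ A i j = 1)
    (m : ℝ) (hm : m = ∑ i, ∑ j, A i j)
    (β : Fin n → Fin k)
    (u : Fin k → ℕ)
    (hu : ∀ g, u g =
      ((Finset.univ.filter (fun i => β i = g ∧ 0 < ∑ j, A i j)).image
        (fun i => ∑ j, A i j)).card) :
    (∑ g, (u g : ℝ)) ≤ Real.sqrt (2 * k * m) := by
  classical
  have hd : ∀ i, ∃ d : ℕ, ∑ j, A i j = (d : ℝ) := by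
    intro i
    have h : ∀ j, ∃ d : ℕ, A i j = (d : ℝ) := by
      intro j
      rcases h01 i j with h | h
      · exact ⟨0, by simp [h]⟩
      · exact ⟨1, by simp [h]⟩
    choose e he using h
    exact ⟨∑ j, e j, by simp [he]⟩
  choose d hd using hd
  have hu2 : ∀ g, (u g) ^ 2 ≤ 2 * ∑ i ∈ Finset.univ.filter (fun i => β i = g), d i := by
    intro g
    have h1 : u g = ((Finset.univ.filter (fun i => β i = g ∧ 0 < d i)).image d).card := by
      rw [hu g]
      simp only [hd, Nat.cast_pos]
      rw [← Finset.card_image_of_injective _ (Nat.cast_injective (R := ℝ)), Finset.image_image]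
      rfl
    rw [h1]
    refine (card_sq_le_two_sum _ ?_).trans ?_
    · intro x hx
      simp only [Finset.mem_image, Finset.mem_filter] at hx
      obtain ⟨i, hi, rfl⟩ := hx
      exact hi.2.2
    · refine Nat.mul_le_mul_left 2 ((sum_image_id_le _ d).trans ?_)
      refine Finset.sum_le_sum_of_subset ?_
      intro i hi
      simp only [Finset.mem_filter] at hi ⊢
      exact ⟨hi.1, hi.2.1⟩
  have hs : ∑ g, (u g) ^ 2 ≤ 2 * ∑ i, d i := by
    rw [← Finset.sum_fiberwise Finset.univ β d, Finset.mul_sum]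
    exact Finset.sum_le_sum (fun g _ => hu2 g)
  have hs' : ∑ g, (u g : ℝ) ^ 2 ≤ 2 * m := by
    rw [hm]
    simp only [hd]
    exact_mod_cast hs
  apply Real.le_sqrt_of_sq_le
  have hc := sq_sum_le_card_mul_sum_sq (s := (Finset.univ : Finset (Fin k))) (f := fun g => (u g : ℝ))
  simp only [Finset.card_univ, Fintype.card_fin] at hc
  have hk : (0 : ℝ) ≤ k := Nat.cast_nonneg k
  nlinarith [mul_le_mul_of_nonneg_left hs' hk]
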